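/- Let G be a finite simple graph that has a bipartition, let x be a vertex, and let y and z be neighbours of x such that N(N(x)) ⊆ N(y) ∪ N(z). Then y is rare or z is rare. -/

import Mathlib

/-- A set of vertices is stable (independent): no two of its vertices are adjacent. -/
def IsStable {V : Type*} (G : SimpleGraph V) (S : Set V) : Prop :=
  ∀ ⦃u⦄, u ∈ S → ∀ ⦃v⦄, v ∈ S → ¬G.Adj u v

/-- A maximal stable set: stable, and every vertex outside has a neighbour inside. -/
def IsMaxStable {V : Type*} (G : SimpleGraph V) (S : Set V) : Prop :=
  IsStable G S ∧ ∀ v ∉ S, ∃ u ∈ S, G.Adj v u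

/-- The set of all maximal stable sets of `G`. -/
def MSS {V : Type*} (G : SimpleGraph V) : Set (Set V) := {S | IsMaxStable G S}

/-- The number of maximal stable sets of `G` containing all vertices of `X`. -/
noncomputable def mssOn {V : Type*} (G : SimpleGraph V) (X : Set V) : ℕ :=
  {S | S ∈ MSS G ∧ X ⊆ S}.ncard

/-- A vertex is rare if it lies in at most half of the maximal stable sets. -/
def Rare {V : Type*} (G : SimpleGraph V) (v : V) : Prop :=
  2 * mssOn G {v} ≤ (MSS G).ncard

/-- The neighbourhood of a set of vertices: all vertices with a neighbour in `A`. -/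
def NSet {V : Type*} (G : SimpleGraph V) (A : Set V) : Set V := {v | ∃ u ∈ A, G.Adj v u}

/-- A bipartition of `G`: a partition of the vertex set into two stable sets. -/
def IsBipartition {V : Type*} (G : SimpleGraph V) (U W : Set V) : Prop :=
  U ∪ W = Set.univ ∧ Disjoint U W ∧ IsStable G U ∧ IsStable G W

theorem IsBipartition.symm {V : Type*} {G : SimpleGraph V} {U W : Set V}
    (h : IsBipartition G U W) : IsBipartition G W U :=
  ⟨Set.union_comm U W ▸ h.1, h.2.1.symm, h.2.2.2, h.2.2.1⟩

/-- The stable set consisting of the part of `S` in `W` without the neighbours of `x`, together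
with all vertices of `U` that have no neighbour in that part. -/
def shiftToward {V : Type*} (G : SimpleGraph V) (U W : Set V) (x : V) (S : Set V) : Set V :=
  (S ∩ W) \ G.neighborSet x ∪ {u ∈ U | ∀ w ∈ (S ∩ W) \ G.neighborSet x, ¬G.Adj u w}

theorem mem_shiftToward_self {V : Type*} {G : SimpleGraph V} {U W : Set V} {x : V}
    (hx : x ∈ U) (S : Set V) : x ∈ shiftToward G U W x S :=
  Or.inr ⟨hx, fun _ hw => hw.2⟩

theorem IsMaxStable.shiftToward {V : Type*} {G : SimpleGraph V} {U W : Set V}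
    (hb : IsBipartition G U W) {x : V} (hx : x ∈ U) {S : Set V} (hS : IsMaxStable G S) :
    IsMaxStable G (shiftToward G U W x S) := by
  obtain ⟨hUW, -, hU, hW⟩ := hb
  have hcover (v : V) : v ∈ U ∨ v ∈ W := hUW.ge (Set.mem_univ v)
  refine ⟨?_, fun v hv => ?_⟩
  · rintro u (hu | hu) v (hv | hv) huv
    · exact hW hu.1.2 hv.1.2 huv
    · exact hv.2 u hu huv.symm
    · exact hu.2 v hv huv
    · exact hU hu.1 hv.1 huv
  · rcases hcover v with hvU | hvW
    · by_contra! hno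
      exact hv (Or.inr ⟨hvU, fun w hw => hno w (Or.inl hw)⟩)
    · by_cases hxv : G.Adj x v
      · exact ⟨x, mem_shiftToward_self hx S, hxv.symm⟩
      · have hvS : v ∉ S := fun hvS => hv (Or.inl ⟨⟨hvS, hvW⟩, hxv⟩)
        obtain ⟨u, huS, hvu⟩ := hS.2 v hvS
        have huU : u ∈ U := (hcover u).resolve_right fun huW => hW hvW huW hvu
        exact ⟨u, Or.inr ⟨huU, fun w hw => hS.1 huS hw.1.1⟩, hvu⟩

theorem shiftToward_inter {V : Type*} {G : SimpleGraph V} {U W : Set V}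
    (hb : IsBipartition G U W) (x : V) (S : Set V) :
    shiftToward G U W x S ∩ W = (S ∩ W) \ G.neighborSet x := by
  ext v
  refine ⟨?_, fun hv => ⟨Or.inl hv, hv.1.2⟩⟩
  rintro ⟨hv | hv, hvW⟩
  · exact hv
  · exact absurd hvW (Set.disjoint_left.1 hb.2.1 hv.1)

/-- A maximal stable set of a bipartite graph is determined by its part in one side. -/
theorem IsMaxStable.subset_of_inter_eq {V : Type*} {G : SimpleGraph V} {U W : Set V}
    (hb : IsBipartition G U W) {S T : Set V} (hS : IsMaxStable G S) (hT : IsMaxStable G T)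
    (h : S ∩ W = T ∩ W) : S ⊆ T := by
  intro v hv
  rcases hb.1.ge (Set.mem_univ v) with hvU | hvW
  · by_contra hvT
    obtain ⟨u, huT, hvu⟩ := hT.2 v hvT
    have huW : u ∈ W :=
      (hb.1.ge (Set.mem_univ u)).resolve_left fun huU => hb.2.2.1 hvU huU hvu
    exact hS.1 hv (h.ge ⟨huT, huW⟩).1 hvu
  · exact (h.le ⟨hv, hvW⟩).1

theorem IsMaxStable.neighborSet_subset {V : Type*} {G : SimpleGraph V} {x y z : V}
    (h : NSet G (G.neighborSet x) ⊆ G.neighborSet y ∪ G.neighborSet z) {S : Set V}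
    (hS : IsMaxStable G S) (hy : y ∈ S) (hz : z ∈ S) : G.neighborSet x ⊆ S := by
  intro w hw
  by_contra hwS
  obtain ⟨u, huS, hwu⟩ := hS.2 w hwS
  rcases h ⟨w, hw, hwu.symm⟩ with hu | hu
  · exact hS.1 hy huS hu
  · exact hS.1 hz huS hu

/-- If `y` and `z` are neighbours of `x` in a graph admitting a bipartition and the second
neighbourhood of `x` is contained in `N(y) ∪ N(z)`, then `y` or `z` is rare. -/
theorem rare_of_second_neighborhood_two {V : Type} [Fintype V] (G : SimpleGraph V)
    (hb : ∃ U W, IsBipartition G U W) (x y z : V) (hxy : G.Adj x y) (hxz : G.Adj x z)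
    (h : NSet G (G.neighborSet x) ⊆ G.neighborSet y ∪ G.neighborSet z) :
    Rare G y ∨ Rare G z := by

  obtain ⟨U, W, hb, hx⟩ : ∃ U W, IsBipartition G U W ∧ x ∈ U := by
    obtain ⟨U, W, hb⟩ := hb
    rcases hb.1.ge (Set.mem_univ x) with hx | hx
    exacts [⟨U, W, hb, hx⟩, ⟨W, U, hb.symm, hx⟩]
  have hxW : G.neighborSet x ⊆ W := fun w hw =>
    (hb.1.ge (Set.mem_univ w)).resolve_left fun hwU => hb.2.2.1 hx hwU hw
  set Y : Set (Set V) := {S | S ∈ MSS G ∧ {y} ⊆ S} with hY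
  set Z : Set (Set V) := {S | S ∈ MSS G ∧ {z} ⊆ S} with hZ
  have hsub : Y ∪ Z ⊆ MSS G := Set.union_subset (fun _ hS => hS.1) fun _ hS => hS.1
  have hle : (Y ∩ Z).ncard ≤ (MSS G \ (Y ∪ Z)).ncard := by
    refine Set.ncard_le_ncard_of_injOn (shiftToward G U W x) ?_ ?_ (Set.toFinite _)
    · rintro S ⟨⟨hS, -⟩, -⟩
      have hS' := IsMaxStable.shiftToward hb hx hS
      have hxS := mem_shiftToward_self (G := G) (W := W) hx S
      refine ⟨hS', ?_⟩
      rintro (⟨-, hy⟩ | ⟨-, hz⟩)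
      · exact hS'.1 hxS (hy rfl) hxy
      · exact hS'.1 hxS (hz rfl) hxz
    · have key (S : Set V) (hS : S ∈ Y ∩ Z) :
          S ∩ W = shiftToward G U W x S ∩ W ∪ G.neighborSet x := by
        rw [shiftToward_inter hb, Set.sdiff_union_of_subset]
        exact Set.subset_inter
          (IsMaxStable.neighborSet_subset h hS.1.1 (hS.1.2 rfl) (hS.2.2 rfl)) hxW
      intro S hS T hT hST
      have hW : S ∩ W = T ∩ W := by rw [key S hS, key T hT, hST]
      exact (IsMaxStable.subset_of_inter_eq hb hS.1.1 hT.1.1 hW).antisymm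
        (IsMaxStable.subset_of_inter_eq hb hT.1.1 hS.1.1 hW.symm)
  have hunion := Set.ncard_union_add_ncard_inter Y Z (Set.toFinite _) (Set.toFinite _)
  have hdiff := Set.ncard_sdiff_add_ncard_of_subset hsub (Set.toFinite _)
  change 2 * Y.ncard ≤ _ ∨ 2 * Z.ncard ≤ _
  omega
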